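/- arXiv:2210.07950 — 6 statements merged into one kernel-verified Lean document; each statement's English description precedes it below -/
import Mathlib

section
/- Let m > 1 and let r : (0,∞) → (0,∞) be continuous with r(x) ≤ r₀(1+x). Let β : (0,∞) → ℝ be locally absolutely continuous with 0 ≤ β(x) ≤ β_k(1+x^k) for some 0 ≤ k < m and |β'(x)| ≤ C(1+x^{m−1}) for some C > 0. Let u be such that u ∈ X_m, ru is locally absolutely continuous with (ru)' ∈ X_m, and lim_{x→0⁺} r(x)u(x) = 0. Then both integrals below converge absolutely and ∫₀^∞ β(x)(ru)'(x) dx = −∫₀^∞ β'(x) r(x) u(x) dx (in particular lim_{x→∞} β(x)r(x)u(x) = 0). -/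
open MeasureTheory Set Filter

/-- A power on the positive half-line is dominated by one plus any larger power. -/
lemma rpow_le_one_add_rpow {x p q : ℝ} (hx : 0 < x) (hp : 0 ≤ p) (hpq : p ≤ q) :
    x ^ p ≤ 1 + x ^ q := by
  rcases le_total x 1 with h | h
  · linarith [Real.rpow_le_one hx.le h hp, Real.rpow_nonneg hx.le q]
  · linarith [Real.rpow_le_rpow_of_exponent_le h hpq]

/-- Integration by parts for functions given as primitives of integrable functions. -/
lemma integral_mul_add_mul_eq_sub_of_primitive {f g f' g' : ℝ → ℝ} {a b : ℝ} (hab : a ≤ b)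
    (hf' : IntervalIntegrable f' volume a b) (hg' : IntervalIntegrable g' volume a b)
    (hf : ∀ x ∈ Icc a b, f x - f a = ∫ s in a..x, f' s)
    (hg : ∀ x ∈ Icc a b, g x - g a = ∫ s in a..x, g' s) :
    ∫ x in a..b, (f x * g' x + f' x * g x) = f b * g b - f a * g a := by
  have hac (c : ℝ) {φ : ℝ → ℝ} (hφ : IntervalIntegrable φ volume a b) :
      AbsolutelyContinuousOnInterval (fun x => c + ∫ s in a..x, φ s) a b :=
    ((LipschitzWith.const c).lipschitzOnWith.absolutelyContinuousOnInterval).add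
      (hφ.absolutelyContinuousOnInterval_intervalIntegral left_mem_uIcc)
  have key := (hac (f a) hf').integral_deriv_mul_eq_sub (hac (g a) hg')
  rw [← hf b (right_mem_Icc.2 hab), ← hg b (right_mem_Icc.2 hab)] at key
  simp only [intervalIntegral.integral_same, add_zero, add_sub_cancel] at key
  rw [← key]
  apply intervalIntegral.integral_congr_ae
  filter_upwards [hf'.ae_hasDerivAt_integral, hg'.ae_hasDerivAt_integral] with x hxf hxg hx
  have hx' := uIoc_subset_uIcc hx
  have hxI : x ∈ Icc a b := by rwa [uIcc_of_le hab] at hx'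
  rw [((hxf hx' a left_mem_uIcc).const_add (f a)).deriv,
    ((hxg hx' a left_mem_uIcc).const_add (g a)).deriv, ← hf x hxI, ← hg x hxI]
  ring

/-- A local primitive on the positive half-line is continuous there. -/
lemma continuousOn_Ioi_of_primitive {f f' : ℝ → ℝ}
    (hf' : ∀ a b, 0 < a → a ≤ b → IntervalIntegrable f' volume a b)
    (hf : ∀ a b, 0 < a → a ≤ b → f b - f a = ∫ s in a..b, f' s) :
    ContinuousOn f (Ioi 0) := by
  intro x hx
  have hx : 0 < x := hx
  have hle : x / 2 ≤ x + 1 := by linarith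
  have hcont : ContinuousOn (fun y => f (x / 2) + ∫ s in (x / 2)..y, f' s)
      (Icc (x / 2) (x + 1)) := by
    refine continuousOn_const.add ?_
    rw [← uIcc_of_le hle]
    exact ((hf' _ _ (half_pos hx) hle).absolutelyContinuousOnInterval_intervalIntegral
      left_mem_uIcc).continuousOn
  have hcont' : ContinuousOn f (Icc (x / 2) (x + 1)) :=
    hcont.congr fun y hy => by linarith [hf _ y (half_pos hx) hy.1]
  exact (hcont'.continuousAt (Icc_mem_nhds (by linarith) (by linarith))).continuousWithinAt

/-- The intervals `(x⁻¹, x]` exhaust the positive half-line. -/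
lemma tendsto_integral_inv_self_Ioi {h : ℝ → ℝ} (hh : IntegrableOn h (Ioi 0)) :
    Tendsto (fun x : ℝ => ∫ s in x⁻¹..x, h s) atTop (nhds (∫ s in Ioi 0, h s)) := by
  have hcover : AECover (volume.restrict (Ioi (0 : ℝ))) atTop fun x : ℝ => Ioc x⁻¹ x := by
    refine ⟨?_, fun _ => measurableSet_Ioc⟩
    filter_upwards [ae_restrict_mem measurableSet_Ioi] with y hy
    filter_upwards [tendsto_inv_atTop_zero.eventually_lt_const (mem_Ioi.1 hy),
      eventually_ge_atTop y] with x h1 h2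
    exact ⟨h1, h2⟩
  refine (hcover.integral_tendsto_of_countably_generated hh).congr' ?_
  filter_upwards [eventually_ge_atTop (1 : ℝ)] with x hx
  have hx0 : 0 < x⁻¹ := inv_pos.2 (by linarith)
  rw [intervalIntegral.integral_of_le ((inv_le_one_of_one_le₀ hx).trans hx),
    Measure.restrict_restrict measurableSet_Ioc,
    inter_eq_left.2 (show Ioc x⁻¹ x ⊆ Ioi 0 from fun y hy => hx0.trans hy.1)]

/-- A function dominated by a multiple of a weighted integrable function is integrable. -/
lemma integrableOn_Ioi_of_abs_le_weight {g v : ℝ → ℝ} {m K : ℝ}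
    (hg : AEStronglyMeasurable g (volume.restrict (Ioi 0)))
    (hv : IntegrableOn (fun x => v x * (1 + x ^ m)) (Ioi 0))
    (h : ∀ x, 0 < x → |g x| ≤ K * (|v x| * (1 + x ^ m))) :
    IntegrableOn g (Ioi 0) := by
  refine Integrable.mono' (hv.abs.const_mul K) hg ?_
  filter_upwards [ae_restrict_mem measurableSet_Ioi] with x hx
  have := Real.rpow_nonneg (le_of_lt hx) m
  rw [Real.norm_eq_abs, abs_mul, abs_of_nonneg (by positivity : 0 ≤ 1 + x ^ m)]
  exact h x hx

/-- An integrable local primitive of an integrable function is minus the tail integral. -/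
lemma eq_neg_integral_Ioi_of_primitive {w w' : ℝ → ℝ} (hw : IntegrableOn w (Ioi 0))
    (hw' : IntegrableOn w' (Ioi 0))
    (hFTC : ∀ a b, 0 < a → a ≤ b → w b - w a = ∫ s in a..b, w' s) {x : ℝ} (hx : 0 < x) :
    w x = -∫ s in Ioi x, w' s := by
  have hlim : Tendsto w atTop (nhds (w x + ∫ s in Ioi x, w' s)) := by
    refine ((intervalIntegral_tendsto_integral_Ioi x (hw'.mono_set (Ioi_subset_Ioi hx.le))
      tendsto_id).const_add (w x)).congr' ?_
    filter_upwards [eventually_ge_atTop x] with y hy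
    simp only [id, ← hFTC x y hx hy, add_sub_cancel]
  have hint : IntegrableAtFilter w atTop := ⟨Ioi 0, Ioi_mem_atTop 0, hw⟩
  have hzero := hint.eq_zero_of_tendsto (fun s hs => by
    obtain ⟨b, hb⟩ := mem_atTop_sets.1 hs
    rw [← top_le_iff, ← Real.volume_Ici (a := b)]
    exact measure_mono hb) hlim
  linarith

/-- Integration by parts against the boundary functional: if `β` is locally
absolutely continuous with `0 ≤ β(x) ≤ β_k(1+x^k)` (`0 ≤ k < m`) and `|β'(x)| ≤ C(1+x^{m-1})`,
and `u ∈ X_m` with `ru` locally absolutely continuous, `(ru)' ∈ X_m`, `r u → 0` at `0⁺`,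
then `∫₀^∞ β (ru)' = −∫₀^∞ β' r u`, both integrals converging absolutely, and
`β(x) r(x) u(x) → 0` as `x → ∞`. -/
theorem integration_by_parts_beta (m k C r₀ betak : ℝ) (r β dβ u du : ℝ → ℝ)
    (hm : 1 < m) (hr₀ : 0 < r₀) (hk0 : 0 ≤ k) (hkm : k < m) (hC : 0 < C)
    (hr_cont : ContinuousOn r (Ioi 0))
    (hr_pos : ∀ x, 0 < x → 0 < r x)
    (hr_bound : ∀ x, 0 < x → r x ≤ r₀ * (1 + x))
    (hβ_nonneg : ∀ x, 0 < x → 0 ≤ β x)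
    (hβ_bound : ∀ x, 0 < x → β x ≤ betak * (1 + x ^ k))
    (hdβ_meas : Measurable dβ)
    (hβ_FTC : ∀ x₀ x₁ : ℝ, 0 < x₀ → x₀ ≤ x₁ → β x₁ - β x₀ = ∫ s in x₀..x₁, dβ s)
    (hdβ_bound : ∀ x, 0 < x → |dβ x| ≤ C * (1 + x ^ (m - 1)))
    (hu_meas : Measurable u)
    (hu_int : IntegrableOn (fun x => u x * (1 + x ^ m)) (Ioi 0))
    (hdu_meas : Measurable du)
    (hdu_int : IntegrableOn (fun x => du x * (1 + x ^ m)) (Ioi 0))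
    (hru_FTC : ∀ x₀ x₁ : ℝ, 0 < x₀ → x₀ ≤ x₁ →
      r x₁ * u x₁ - r x₀ * u x₀ = ∫ s in x₀..x₁, du s)
    (hbc : Tendsto (fun x => r x * u x) (nhdsWithin 0 (Ioi 0)) (nhds 0)) :
    IntegrableOn (fun x => β x * du x) (Ioi 0) ∧
    IntegrableOn (fun x => dβ x * (r x * u x)) (Ioi 0) ∧
    (∫ x in Ioi 0, β x * du x) = -∫ x in Ioi 0, dβ x * (r x * u x) ∧
    Tendsto (fun x => β x * (r x * u x)) atTop (nhds 0) := by
  have hu_abs : ∀ x, 0 < x → |r x * u x| ≤ r₀ * (1 + x) * |u x| := fun x hx => by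
    rw [abs_mul, abs_of_pos (hr_pos x hx)]
    exact mul_le_mul_of_nonneg_right (hr_bound x hx) (abs_nonneg _)
  have hbetak : 0 ≤ betak := by
    have := (hβ_nonneg 1 one_pos).trans (hβ_bound 1 one_pos)
    rw [Real.one_rpow] at this
    linarith
  have hβ_le : ∀ x, 0 < x → β x ≤ 2 * betak * (1 + x ^ m) := fun x hx => by
    have h1 := rpow_le_one_add_rpow hx hk0 hkm.le
    have h2 := Real.rpow_nonneg hx.le m
    nlinarith [hβ_bound x hx, mul_le_mul_of_nonneg_left h1 hbetak, mul_nonneg hbetak h2]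
  have hdβ_int : ∀ a b, 0 < a → a ≤ b → IntervalIntegrable dβ volume a b := by
    intro a b ha hab
    have hdom : ContinuousOn (fun x : ℝ => C * (1 + x ^ (m - 1))) (uIcc a b) :=
      continuousOn_const.mul (continuousOn_const.add
        (continuousOn_id.rpow_const fun x _ => Or.inr (by linarith)))
    refine hdom.intervalIntegrable.mono_fun' hdβ_meas.aestronglyMeasurable ?_
    filter_upwards [ae_restrict_mem measurableSet_uIoc] with x hx
    rw [uIoc_of_le hab] at hx
    exact hdβ_bound x (ha.trans hx.1)
  have hβ_meas : AEStronglyMeasurable β (volume.restrict (Ioi 0)) :=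
    (continuousOn_Ioi_of_primitive hdβ_int hβ_FTC).aestronglyMeasurable measurableSet_Ioi
  have hru_meas : AEStronglyMeasurable (fun x => r x * u x) (volume.restrict (Ioi 0)) :=
    (hr_cont.aestronglyMeasurable measurableSet_Ioi).mul hu_meas.aestronglyMeasurable
  have hdu : IntegrableOn du (Ioi 0) :=
    integrableOn_Ioi_of_abs_le_weight (K := 1) hdu_meas.aestronglyMeasurable hdu_int
      fun x hx => by
        have := mul_nonneg (abs_nonneg (du x)) (Real.rpow_nonneg hx.le m)
        linarith
  have hru : IntegrableOn (fun x => r x * u x) (Ioi 0) := by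
    refine integrableOn_Ioi_of_abs_le_weight (K := 2 * r₀) hru_meas hu_int fun x hx => ?_
    have h1 := rpow_le_one_add_rpow hx zero_le_one hm.le
    rw [Real.rpow_one] at h1
    have h2 := Real.rpow_nonneg hx.le m
    calc |r x * u x| ≤ r₀ * (1 + x) * |u x| := hu_abs x hx
      _ ≤ r₀ * (2 * (1 + x ^ m)) * |u x| := by gcongr; linarith
      _ = _ := by ring
  have hβdu : IntegrableOn (fun x => β x * du x) (Ioi 0) := by
    refine integrableOn_Ioi_of_abs_le_weight (K := 2 * betak)
      (hβ_meas.mul hdu_meas.aestronglyMeasurable) hdu_int fun x hx => ?_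
    rw [abs_mul, abs_of_nonneg (hβ_nonneg x hx)]
    calc β x * |du x| ≤ 2 * betak * (1 + x ^ m) * |du x| := by gcongr; exact hβ_le x hx
      _ = _ := by ring
  have hdβru : IntegrableOn (fun x => dβ x * (r x * u x)) (Ioi 0) := by
    refine integrableOn_Ioi_of_abs_le_weight (K := 3 * C * r₀)
      (hdβ_meas.aestronglyMeasurable.mul hru_meas) hu_int fun x hx => ?_
    have h1 := rpow_le_one_add_rpow hx zero_le_one hm.le
    rw [Real.rpow_one] at h1
    have h2 := rpow_le_one_add_rpow hx (by linarith : 0 ≤ m - 1) (by linarith : m - 1 ≤ m)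
    have h3 : x ^ (m - 1) * x = x ^ m := by
      rw [← Real.rpow_add_one hx.ne', sub_add_cancel]
    have h4 := Real.rpow_nonneg hx.le (m - 1)
    rw [abs_mul]
    calc |dβ x| * |r x * u x|
        ≤ C * (1 + x ^ (m - 1)) * (r₀ * (1 + x) * |u x|) := by
          gcongr
          · exact hdβ_bound x hx
          · exact hu_abs x hx
      _ = C * r₀ * |u x| * ((1 + x ^ (m - 1)) * (1 + x)) := by ring
      _ ≤ C * r₀ * |u x| * (3 * (1 + x ^ m)) :=
        mul_le_mul_of_nonneg_left (by linarith) (by positivity)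
      _ = _ := by ring
  have htop : Tendsto (fun x => β x * (r x * u x)) atTop (nhds 0) := by
    have htail := (tendsto_integral_Ioi_zero (μ := volume)
      (f := fun s => |du s * (1 + s ^ m)|) tendsto_id).const_mul (2 * betak)
    rw [mul_zero] at htail
    refine squeeze_zero_norm' ?_ htail
    filter_upwards [eventually_gt_atTop 0] with x hx
    have hsub : Ioi x ⊆ Ioi (0 : ℝ) := Ioi_subset_Ioi hx.le
    have hxm := Real.rpow_nonneg hx.le m
    rw [Real.norm_eq_abs, abs_mul, abs_of_nonneg (hβ_nonneg x hx),
      eq_neg_integral_Ioi_of_primitive hru hdu hru_FTC hx, abs_neg]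
    calc β x * |∫ s in Ioi x, du s|
        ≤ 2 * betak * (1 + x ^ m) * ∫ s in Ioi x, |du s| := by
          gcongr
          · exact hβ_le x hx
          · exact abs_integral_le_integral_abs
      _ = 2 * betak * ∫ s in Ioi x, (1 + x ^ m) * |du s| := by
          rw [integral_const_mul]; ring
      _ ≤ 2 * betak * ∫ s in Ioi x, |du s * (1 + s ^ m)| := by
          refine mul_le_mul_of_nonneg_left ?_ (by positivity)
          refine setIntegral_mono_on ((hdu.mono_set hsub).abs.const_mul _)
            (hdu_int.mono_set hsub).abs measurableSet_Ioi fun s hs => ?_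
          have hs : x < s := hs
          have hsm : x ^ m ≤ s ^ m := Real.rpow_le_rpow hx.le hs.le (by linarith)
          rw [abs_mul, abs_of_nonneg (by linarith : 0 ≤ 1 + s ^ m), mul_comm]
          gcongr
  have hzero : Tendsto (fun x => β x * (r x * u x)) (nhdsWithin 0 (Ioi 0)) (nhds 0) := by
    have hlim := hbc.abs.const_mul (4 * betak)
    rw [abs_zero, mul_zero] at hlim
    refine squeeze_zero_norm' ?_ hlim
    filter_upwards [Ioo_mem_nhdsGT (zero_lt_one' ℝ)] with x hx
    rw [Real.norm_eq_abs, abs_mul, abs_of_nonneg (hβ_nonneg x hx.1)]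
    gcongr
    nlinarith [hβ_le x hx.1, Real.rpow_le_one hx.1.le hx.2.le (by linarith : 0 ≤ m)]
  refine ⟨hβdu, hdβru, ?_, htop⟩
  rw [eq_neg_iff_add_eq_zero, ← integral_add hβdu hdβru]
  refine tendsto_nhds_unique (tendsto_integral_inv_self_Ioi (hβdu.add hdβru)) ?_
  have hbdry := htop.sub (hzero.comp tendsto_inv_atTop_nhdsGT_zero)
  rw [sub_zero] at hbdry
  refine hbdry.congr' ?_
  filter_upwards [eventually_ge_atTop (1 : ℝ)] with x hx
  have hx0 : 0 < x⁻¹ := inv_pos.2 (by linarith)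
  have hle : x⁻¹ ≤ x := (inv_le_one_of_one_le₀ hx).trans hx
  exact (integral_mul_add_mul_eq_sub_of_primitive hle (hdβ_int _ _ hx0 hle)
    ((intervalIntegrable_iff_integrableOn_Ioc_of_le hle).2
      (hdu.mono_set fun y hy => hx0.trans hy.1))
    (fun y hy => hβ_FTC _ y hx0 hy.1) (fun y hy => hru_FTC _ y hx0 hy.1)).symm
end

section
/- Let c : [0,∞) → [0,∞) be nondecreasing with c(z) ≤ z for all z ≥ 0, let c⁽ⁿ⁾ denote its n-th iterate, let c_∞(z) = lim_{n→∞} c⁽ⁿ⁾(z) (the limit exists since the iterates are nonincreasing and bounded below), and set c̄ = sup_{z>0} c_∞(z); assume c̄ < ∞. If c(c̄) ≥ c̄, then c_∞(z) = c̄ for every z ≥ c̄. -/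
open Filter Set

/-- (Lemma on the iterates of `c`, case 1.) Let `c` be nondecreasing on
`[0,∞)` with `0 ≤ c(z) ≤ z`, let `c_∞(z) = lim_n c⁽ⁿ⁾(z)` and `c̄ = sup_{z>0} c_∞(z)` (assumed
finite, i.e. a least upper bound exists). If `c(c̄) ≥ c̄`, then `c_∞(z) = c̄` for every `z ≥ c̄`. -/
theorem iterates_case1 (c cinf : ℝ → ℝ) (cbar : ℝ)
    (hc_nonneg : ∀ z, 0 ≤ z → 0 ≤ c z)
    (hc_mono : ∀ z₁ z₂, 0 ≤ z₁ → z₁ ≤ z₂ → c z₁ ≤ c z₂)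
    (hc_le : ∀ z, 0 ≤ z → c z ≤ z)
    (hcinf : ∀ z, 0 ≤ z → Tendsto (fun n => c^[n] z) atTop (nhds (cinf z)))
    (hlub : IsLUB (cinf '' Ioi 0) cbar)
    (hfix : cbar ≤ c cbar) :
    ∀ z, cbar ≤ z → cinf z = cbar := by
  have iterate_nonneg : ∀ z, 0 ≤ z → ∀ n, 0 ≤ c^[n] z := by
    intro z hz n
    induction n with
    | zero => exact hz
    | succ n ih =>
      rw [Function.iterate_succ_apply']
      exact hc_nonneg _ ih
  have iterate_le : ∀ z, 0 ≤ z → ∀ n, c^[n] z ≤ z := by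
    intro z hz n
    induction n with
    | zero => exact le_rfl
    | succ n ih =>
      rw [Function.iterate_succ_apply']
      exact (hc_le _ (iterate_nonneg z hz n)).trans ih
  have hbar : 0 ≤ cbar :=
    (ge_of_tendsto' (hcinf 1 zero_le_one) (iterate_nonneg 1 zero_le_one)).trans
      (hlub.1 ⟨1, mem_Ioi.2 one_pos, rfl⟩)
  intro z hz
  have hz0 : 0 ≤ z := hbar.trans hz
  have le_iterate : ∀ n, cbar ≤ c^[n] z := by
    intro n
    induction n with
    | zero => exact hz
    | succ n ih =>
      rw [Function.iterate_succ_apply']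
      exact hfix.trans (hc_mono _ _ hbar ih)
  refine le_antisymm ?_ (ge_of_tendsto' (hcinf z hz0) le_iterate)
  rcases hz0.eq_or_lt with rfl | hpos
  · exact (le_of_tendsto' (hcinf 0 le_rfl) (iterate_le 0 le_rfl)).trans hbar
  · exact hlub.1 ⟨z, hpos, rfl⟩
end

section
/- Let c : [0,∞) → [0,∞) be nondecreasing with c(z) ≤ z for all z ≥ 0, let c⁽ⁿ⁾ denote its n-th iterate, let c_∞(z) = lim_{n→∞} c⁽ⁿ⁾(z) (the limit exists since the iterates are nonincreasing and bounded below), and set c̄ = sup_{z>0} c_∞(z); assume c̄ < ∞. If c(c̄) < c̄, then for every z > c̄ one has c(z) > c̄ and c_∞(z) = c̄; in particular the supremum defining c̄ is attained, i.e. c̄ = max_{z>0} c_∞(z). -/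
open Filter Set

/-- The iterates of a map that is nonnegative on `[0,∞)` stay nonnegative. -/
lemma iterate_nonneg_of_nonneg {c : ℝ → ℝ} (hc_nonneg : ∀ z, 0 ≤ z → 0 ≤ c z) {z : ℝ}
    (hz : 0 ≤ z) (n : ℕ) : 0 ≤ c^[n] z := by
  induction n with
  | zero => exact hz
  | succ n ih => rw [Function.iterate_succ_apply']; exact hc_nonneg _ ih

/-- The orbits of a nonnegative map lying below the identity on `[0,∞)` are nonincreasing. -/
lemma antitone_iterate_of_nonneg_of_le {c : ℝ → ℝ} (hc_nonneg : ∀ z, 0 ≤ z → 0 ≤ c z)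
    (hc_le : ∀ z, 0 ≤ z → c z ≤ z) {z : ℝ} (hz : 0 ≤ z) : Antitone (fun n => c^[n] z) := by
  refine antitone_nat_of_succ_le fun n => ?_
  rw [Function.iterate_succ_apply']
  exact hc_le _ (iterate_nonneg_of_nonneg hc_nonneg hz n)

/-- (Lemma on the iterates of `c`, case 2.) Let `c` be nondecreasing on
`[0,∞)` with `0 ≤ c(z) ≤ z`, let `c_∞(z) = lim_n c⁽ⁿ⁾(z)` and `c̄ = sup_{z>0} c_∞(z)` (assumed
finite, i.e. a least upper bound exists). If `c(c̄) < c̄`, then for every `z > c̄` one has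
`c(z) > c̄` and `c_∞(z) = c̄`; in particular the supremum defining `c̄` is attained. -/
theorem iterates_case2 (c cinf : ℝ → ℝ) (cbar : ℝ)
    (hc_nonneg : ∀ z, 0 ≤ z → 0 ≤ c z)
    (hc_mono : ∀ z₁ z₂, 0 ≤ z₁ → z₁ ≤ z₂ → c z₁ ≤ c z₂)
    (hc_le : ∀ z, 0 ≤ z → c z ≤ z)
    (hcinf : ∀ z, 0 ≤ z → Tendsto (fun n => c^[n] z) atTop (nhds (cinf z)))
    (hlub : IsLUB (cinf '' Ioi 0) cbar)
    (hfix : c cbar < cbar) :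
    (∀ z, cbar < z → cbar < c z ∧ cinf z = cbar) ∧
    ∃ z, 0 < z ∧ cinf z = cbar := by
  have hub : ∀ y, 0 < y → cinf y ≤ cbar := fun y hy => hlub.1 ⟨y, hy, rfl⟩
  have hle : ∀ y, 0 < y → ∀ n, cinf y ≤ c^[n] y := fun y hy n =>
    (antitone_iterate_of_nonneg_of_le hc_nonneg hc_le hy.le).le_of_tendsto (hcinf y hy.le) n
  have hbar : 0 ≤ cbar :=
    (ge_of_tendsto' (hcinf 1 zero_le_one)
      (iterate_nonneg_of_nonneg hc_nonneg zero_le_one)).trans (hub 1 one_pos)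
  have hgt : ∀ z, cbar < z → cbar < c z := by
    intro z hz
    by_contra! hcz
    refine hfix.not_ge (hlub.2 ?_)
    rintro _ ⟨y, hy, rfl⟩
    have hnn := iterate_nonneg_of_nonneg hc_nonneg (le_of_lt hy)
    obtain ⟨n, hn⟩ : ∃ n, c^[n] y ≤ z := by
      by_contra! h
      exact (hz.trans_le (ge_of_tendsto' (hcinf y (le_of_lt hy)) fun n => (h n).le)).not_ge
        (hub y hy)
    have h₁ : c^[n + 1] y ≤ cbar := by
      rw [Function.iterate_succ_apply']
      exact (hc_mono _ _ (hnn n) hn).trans hcz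
    refine (hle y hy (n + 2)).trans ?_
    rw [Function.iterate_succ_apply']
    exact hc_mono _ _ (hnn (n + 1)) h₁
  have heq : ∀ z, cbar < z → cinf z = cbar := by
    intro z hz
    refine le_antisymm (hub z (hbar.trans_lt hz))
      (ge_of_tendsto' (hcinf z (hbar.trans hz.le)) fun n => ?_)
    suffices h : cbar < c^[n] z from h.le
    induction n with
    | zero => exact hz
    | succ n ih => rw [Function.iterate_succ_apply']; exact hgt _ ih
  exact ⟨fun z hz => ⟨hgt z hz, heq z hz⟩, cbar + 1, by positivity, heq _ (lt_add_one _)⟩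
end

section
/- Let a > 0 and let u₀ : ℝ → ℝ be measurable with ∫_ℝ (1+|s|)|u₀(s)| ds < ∞. Define w(ξ,t) = u₀(ξ) + at ∫_ξ^∞ [2 + at(s−ξ)] u₀(s) ds for ξ ∈ ℝ, t ≥ 0. Then w(ξ,0) = u₀(ξ), and for every ξ ∈ ℝ and t ≥ 0 the integral ∫_ξ^∞ e^{−at(s−ξ)} w(s,t) ds converges absolutely and ∂ₜw(ξ,t) = 2a ∫_ξ^∞ e^{−at(s−ξ)} w(s,t) ds. -/
open MeasureTheory Set Filter

/-- The explicit solution `w = (I + atJ⁺)² u₀` in characteristic coordinates: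
`w(ξ,t) = u₀(ξ) + at ∫_ξ^∞ [2 + at(s−ξ)] u₀(s) ds`. -/
noncomputable def wSol (a : ℝ) (u₀ : ℝ → ℝ) (ξ t : ℝ) : ℝ :=
  u₀ ξ + a * t * ∫ s in Set.Ioi ξ, (2 + a * t * (s - ξ)) * u₀ s

/-- The kernel of the double integral obtained by inserting `wSol` into the right-hand side,
with `c = a * t`. -/
noncomputable def wKernel (c : ℝ) (u₀ : ℝ → ℝ) (ξ s y : ℝ) : ℝ :=
  (Iio y).indicator (fun r => c * Real.exp (-(c * (r - ξ))) * ((2 + c * (y - r)) * u₀ y)) s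

theorem integrableOn_mul_of_le_one_add_abs {u₀ g : ℝ → ℝ} {S : Set ℝ} (C : ℝ)
    (hu₀_meas : Measurable u₀) (hu₀_int : Integrable (fun s => (1 + |s|) * |u₀ s|))
    (hS : MeasurableSet S) (hg : Measurable g) (hC : ∀ s ∈ S, |g s| ≤ C * (1 + |s|)) :
    IntegrableOn (fun s => g s * u₀ s) S := by
  refine Integrable.mono' (hu₀_int.integrableOn.const_mul C)
    (hg.mul hu₀_meas).aestronglyMeasurable ?_
  filter_upwards [ae_restrict_mem hS] with s hs
  rw [Real.norm_eq_abs, abs_mul, ← mul_assoc]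
  exact mul_le_mul_of_nonneg_right (hC s hs) (abs_nonneg _)

theorem integrableOn_Ioi_affine_mul {u₀ : ℝ → ℝ} (hu₀_meas : Measurable u₀)
    (hu₀_int : Integrable (fun s => (1 + |s|) * |u₀ s|)) (ξ α β : ℝ) :
    IntegrableOn (fun s => (α + β * (s - ξ)) * u₀ s) (Ioi ξ) := by
  refine integrableOn_mul_of_le_one_add_abs (|α| + |β| * (1 + |ξ|)) hu₀_meas hu₀_int
    measurableSet_Ioi (by fun_prop) fun s _ => ?_
  calc |α + β * (s - ξ)| ≤ |α| + |β| * |s - ξ| := by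
        rw [← abs_mul]; exact abs_add_le _ _
    _ ≤ |α| + |β| * (|s| + |ξ|) := by gcongr; exact abs_sub _ _
    _ ≤ _ := by
        have := mul_nonneg (abs_nonneg α) (abs_nonneg s)
        have := mul_nonneg (abs_nonneg β) (mul_nonneg (abs_nonneg ξ) (abs_nonneg s))
        have := abs_nonneg β
        nlinarith

theorem integrableOn_Ioi_exp_mul {u₀ : ℝ → ℝ} (hu₀_meas : Measurable u₀)
    (hu₀_int : Integrable (fun s => (1 + |s|) * |u₀ s|)) {c : ℝ} (hc : 0 ≤ c) (ξ : ℝ) :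
    IntegrableOn (fun s => Real.exp (-(c * (s - ξ))) * u₀ s) (Ioi ξ) := by
  refine integrableOn_mul_of_le_one_add_abs 1 hu₀_meas hu₀_int measurableSet_Ioi
    (by fun_prop) fun s hs => ?_
  have h : Real.exp (-(c * (s - ξ))) ≤ 1 :=
    Real.exp_le_one_iff.2 (neg_nonpos.2 (mul_nonneg hc (sub_nonneg.2 (le_of_lt hs))))
  rw [abs_of_pos (Real.exp_pos _)]
  linarith [abs_nonneg s]

theorem setIntegral_Ioi_wKernel (c : ℝ) (u₀ : ℝ → ℝ) {ξ y : ℝ} (hy : ξ < y) :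
    ∫ s in Ioi ξ, wKernel c u₀ ξ s y
      = (1 + c * (y - ξ) - Real.exp (-(c * (y - ξ)))) * u₀ y := by
  unfold wKernel
  rw [setIntegral_indicator measurableSet_Iio, Ioi_inter_Iio, ← integral_Ioc_eq_integral_Ioo,
    ← intervalIntegral.integral_of_le hy.le]
  have key : ∀ r ∈ uIcc ξ y,
      HasDerivAt (fun r => -(Real.exp (-(c * (r - ξ))) * (1 + c * (y - r))) * u₀ y)
        (c * Real.exp (-(c * (r - ξ))) * ((2 + c * (y - r)) * u₀ y)) r := by
    intro r _
    have h1 : HasDerivAt (fun r => Real.exp (-(c * (r - ξ))))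
        (Real.exp (-(c * (r - ξ))) * -(c * 1)) r :=
      (((hasDerivAt_id r).sub_const ξ).const_mul c).neg.exp
    have h2 : HasDerivAt (fun r => 1 + c * (y - r)) _ r :=
      (((hasDerivAt_id r).const_sub y).const_mul c).const_add 1
    refine ((h1.mul h2).neg.mul_const (u₀ y)).congr_deriv ?_
    ring
  rw [intervalIntegral.integral_eq_sub_of_hasDerivAt key
    (Continuous.intervalIntegrable (by fun_prop) _ _)]
  simp
  ring

theorem integrableOn_wKernel_left (c : ℝ) (u₀ : ℝ → ℝ) (ξ y : ℝ) :
    IntegrableOn (fun s => wKernel c u₀ ξ s y) (Ioi ξ) := by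
  unfold wKernel
  rw [IntegrableOn, integrable_indicator_iff measurableSet_Iio, IntegrableOn,
    Measure.restrict_restrict measurableSet_Iio, Iio_inter_Ioi, ← IntegrableOn]
  exact (Continuous.integrableOn_Icc (by fun_prop)).mono_set Ioo_subset_Icc_self

theorem measurable_wKernel (c : ℝ) {u₀ : ℝ → ℝ} (hu₀_meas : Measurable u₀) (ξ : ℝ) :
    Measurable (fun p : ℝ × ℝ => wKernel c u₀ ξ p.1 p.2) := by
  have h : (fun p : ℝ × ℝ => wKernel c u₀ ξ p.1 p.2) = {p : ℝ × ℝ | p.1 < p.2}.indicator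
      (fun p => c * Real.exp (-(c * (p.1 - ξ))) * ((2 + c * (p.2 - p.1)) * u₀ p.2)) := by
    ext p
    simp [wKernel, indicator]
  rw [h]
  refine Measurable.indicator ?_ (measurableSet_lt measurable_fst measurable_snd)
  fun_prop

theorem norm_wKernel {c : ℝ} (hc : 0 ≤ c) (u₀ : ℝ → ℝ) (ξ s y : ℝ) :
    ‖wKernel c u₀ ξ s y‖ = wKernel c (fun r => |u₀ r|) ξ s y := by
  by_cases h : s < y
  · have h2 : 0 ≤ 2 + c * (y - s) := by
      have := mul_nonneg hc (sub_nonneg.2 h.le)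
      linarith
    simp [wKernel, indicator, h, abs_of_nonneg hc, abs_of_nonneg h2]
  · simp [wKernel, indicator, h]

theorem integrableOn_Ioi_marginal {u₀ : ℝ → ℝ} (hu₀_meas : Measurable u₀)
    (hu₀_int : Integrable (fun s => (1 + |s|) * |u₀ s|)) {c : ℝ} (hc : 0 ≤ c) (ξ : ℝ) :
    IntegrableOn (fun y => (1 + c * (y - ξ) - Real.exp (-(c * (y - ξ)))) * u₀ y) (Ioi ξ) := by
  simp_rw [sub_mul (1 + c * _)]
  exact (integrableOn_Ioi_affine_mul hu₀_meas hu₀_int ξ 1 c).sub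
    (integrableOn_Ioi_exp_mul hu₀_meas hu₀_int hc ξ)

theorem integrable_wKernel {u₀ : ℝ → ℝ} (hu₀_meas : Measurable u₀)
    (hu₀_int : Integrable (fun s => (1 + |s|) * |u₀ s|)) {c : ℝ} (hc : 0 ≤ c) (ξ : ℝ) :
    Integrable (fun p : ℝ × ℝ => wKernel c u₀ ξ p.1 p.2)
      ((volume.restrict (Ioi ξ)).prod (volume.restrict (Ioi ξ))) := by
  rw [integrable_prod_iff' (measurable_wKernel c hu₀_meas ξ).aestronglyMeasurable]
  refine ⟨Eventually.of_forall fun y => integrableOn_wKernel_left c u₀ ξ y, ?_⟩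
  have habs : Integrable (fun s => (1 + |s|) * |(|u₀ s|)|) := by simpa using hu₀_int
  refine (integrableOn_Ioi_marginal hu₀_meas.abs habs hc ξ).congr ?_
  filter_upwards [ae_restrict_mem measurableSet_Ioi] with y hy
  simp_rw [norm_wKernel hc]
  exact (setIntegral_Ioi_wKernel c (fun r => |u₀ r|) hy).symm

theorem exp_mul_wSol_eq (a t : ℝ) (u₀ : ℝ → ℝ) {ξ s : ℝ} (hs : ξ < s) :
    Real.exp (-(a * t * (s - ξ))) * wSol a u₀ s t
      = Real.exp (-(a * t * (s - ξ))) * u₀ s + ∫ y in Ioi ξ, wKernel (a * t) u₀ ξ s y := by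
  have h : (fun y => wKernel (a * t) u₀ ξ s y) = (Ioi s).indicator (fun y =>
      a * t * Real.exp (-(a * t * (s - ξ))) * ((2 + a * t * (y - s)) * u₀ y)) := by
    ext y
    simp [wKernel, indicator]
  rw [h, setIntegral_indicator measurableSet_Ioi, inter_eq_right.2 (Ioi_subset_Ioi hs.le),
    integral_const_mul, wSol]
  ring

theorem hasDerivAt_wSol {u₀ : ℝ → ℝ} (hu₀_meas : Measurable u₀)
    (hu₀_int : Integrable (fun s => (1 + |s|) * |u₀ s|)) (a ξ t : ℝ) :
    HasDerivAt (fun τ => wSol a u₀ ξ τ)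
      (2 * a * ∫ s in Ioi ξ, (1 + a * t * (s - ξ)) * u₀ s) t := by
  have hA := integrableOn_Ioi_affine_mul hu₀_meas hu₀_int ξ 1 0
  have hB := integrableOn_Ioi_affine_mul hu₀_meas hu₀_int ξ 0 1
  simp only [zero_mul, add_zero, one_mul, zero_add] at hA hB
  have split (α β : ℝ) : ∫ s in Ioi ξ, (α + β * (s - ξ)) * u₀ s
      = α * (∫ s in Ioi ξ, u₀ s) + β * ∫ s in Ioi ξ, (s - ξ) * u₀ s := by
    simp_rw [add_mul, mul_assoc]
    rw [integral_add (hA.const_mul α) (hB.const_mul β), integral_const_mul, integral_const_mul]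
  simp_rw [wSol, split]
  have h := (hasDerivAt_id t).const_mul a
  refine ((h.mul ((h.mul_const (∫ s in Ioi ξ, (s - ξ) * u₀ s)).const_add
    (2 * ∫ s in Ioi ξ, u₀ s))).const_add (u₀ ξ)).congr_deriv ?_
  simp only [id]
  ring

/-- The function `w(ξ,t) = u₀(ξ) + at ∫_ξ^∞ [2+at(s−ξ)] u₀(s) ds` satisfies
`w(ξ,0) = u₀(ξ)` and solves `∂ₜw(ξ,t) = 2a ∫_ξ^∞ e^{−at(s−ξ)} w(s,t) ds`, the right-hand side
converging absolutely. -/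
theorem wSol_solves (a : ℝ) (ha : 0 < a) (u₀ : ℝ → ℝ)
    (hu₀_meas : Measurable u₀)
    (hu₀_int : Integrable (fun s => (1 + |s|) * |u₀ s|)) :
    (∀ ξ : ℝ, wSol a u₀ ξ 0 = u₀ ξ) ∧
    ∀ ξ t : ℝ, 0 ≤ t →
      IntegrableOn (fun s => Real.exp (-(a * t * (s - ξ))) * wSol a u₀ s t) (Ioi ξ) ∧
      HasDerivAt (fun τ => wSol a u₀ ξ τ)
        (2 * a * ∫ s in Ioi ξ, Real.exp (-(a * t * (s - ξ))) * wSol a u₀ s t) t := by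
  refine ⟨fun ξ => by simp [wSol], fun ξ t ht => ?_⟩
  have hc : 0 ≤ a * t := mul_nonneg ha.le ht
  have hexp := integrableOn_Ioi_exp_mul hu₀_meas hu₀_int hc ξ
  have hker := integrable_wKernel hu₀_meas hu₀_int hc ξ
  constructor
  · refine (hexp.add hker.integral_prod_left).congr ?_
    filter_upwards [ae_restrict_mem measurableSet_Ioi] with s hs
    exact (exp_mul_wSol_eq a t u₀ hs).symm
  · refine (hasDerivAt_wSol hu₀_meas hu₀_int a ξ t).congr_deriv ?_
    congr 1
    rw [setIntegral_congr_fun measurableSet_Ioi fun s hs => exp_mul_wSol_eq a t u₀ hs,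
      integral_add hexp hker.integral_prod_left, integral_integral_swap hker,
      setIntegral_congr_fun measurableSet_Ioi fun y hy => setIntegral_Ioi_wKernel (a * t) u₀ hy,
      ← integral_add hexp (integrableOn_Ioi_marginal hu₀_meas hu₀_int hc ξ)]
    congr 1
    ext s
    ring
end

section
/- Let a, r > 0, β₀, β₁ ≥ 0, α₀ = rβ₀, α₁ = rβ₁ + a. For s₀ ∈ ℝ define v(x) = e^{−(ax+s₀)²/(2ar)}·((ax+s₀)²/(ar) − 1) for x ≥ 0. Then: (i) r v''(x) + (s₀ + ax) v'(x) + 3a v(x) = 0 for all x; (ii) s₀ v(x) + r v'(x) + a x v(x) − 2a ∫_x^∞ v(y) dy = 0 for all x ≥ 0; (iii) if s₀ > 0, then the boundary condition v(0) = β₀ ∫₀^∞ v(y) dy + β₁ ∫₀^∞ y v(y) dy holds if and only if s₀² − α₀s₀ − rα₁ = 0, hence it holds for s₀ = λ₊ = (α₀ + √(α₀² + 4rα₁))/2; (iv) if s₀ ≥ √(ar), then v(x) ≥ 0 for all x ≥ 0. -/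
open MeasureTheory Set

/-- `λ₊ = (α₀ + √(α₀² + 4rα₁))/2`. -/
noncomputable def lamP (r α₀ α₁ : ℝ) : ℝ := (α₀ + Real.sqrt (α₀ ^ 2 + 4 * r * α₁)) / 2

/-- The Perron eigenfunction candidate
`v(x) = e^{−(ax+s₀)²/(2ar)} ((ax+s₀)²/(ar) − 1)`. -/
noncomputable def vP (a r s₀ x : ℝ) : ℝ :=
  Real.exp (-(a * x + s₀) ^ 2 / (2 * a * r)) * ((a * x + s₀) ^ 2 / (a * r) - 1)

/-- The power of an affine function `(a * x + s) ^ n` times a Gaussian in it. -/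
noncomputable def affineGaussian (a r s : ℝ) (n : ℕ) (x : ℝ) : ℝ :=
  (a * x + s) ^ n * Real.exp (-(a * x + s) ^ 2 / (2 * a * r))

lemma vP_eq_affineGaussian (a r s x : ℝ) :
    vP a r s x = affineGaussian a r s 2 x / (a * r) - affineGaussian a r s 0 x := by
  simp only [vP, affineGaussian]
  ring

lemma hasDerivAt_affineGaussian_zero {a r : ℝ} (ha : 0 < a) (hr : 0 < r) (s x : ℝ) :
    HasDerivAt (affineGaussian a r s 0) (-affineGaussian a r s 1 x / r) x := by
  have hu : HasDerivAt (fun x : ℝ => a * x + s) a x := by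
    simpa using ((hasDerivAt_id x).const_mul a).add_const s
  have h := (((hu.pow 2).neg).div_const (2 * a * r)).exp
  have hf : affineGaussian a r s 0 =
      fun y => Real.exp (-(a * y + s) ^ 2 / (2 * a * r)) := by
    ext y
    simp [affineGaussian]
  rw [hf]
  refine h.congr_deriv ?_
  simp only [affineGaussian, Pi.neg_apply, Pi.pow_apply]
  field_simp
  push_cast
  ring

lemma hasDerivAt_affineGaussian_succ {a r : ℝ} (ha : 0 < a) (hr : 0 < r) (s : ℝ) (n : ℕ) (x : ℝ) :
    HasDerivAt (affineGaussian a r s (n + 1))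
      ((n + 1) * a * affineGaussian a r s n x - affineGaussian a r s (n + 2) x / r) x := by
  have hu : HasDerivAt (fun x : ℝ => a * x + s) a x := by
    simpa using ((hasDerivAt_id x).const_mul a).add_const s
  have h := (hu.pow (n + 1)).mul (hasDerivAt_affineGaussian_zero ha hr s x)
  have hf : affineGaussian a r s (n + 1) =
      fun y => (a * y + s) ^ (n + 1) * affineGaussian a r s 0 y := by
    ext y
    simp [affineGaussian]
  rw [hf]
  refine h.congr_deriv ?_
  simp only [affineGaussian, Pi.pow_apply, Nat.cast_add, Nat.cast_one, Nat.add_sub_cancel]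
  ring

lemma integrable_affineGaussian {a r : ℝ} (ha : 0 < a) (hr : 0 < r) (s : ℝ) (n : ℕ) :
    Integrable (affineGaussian a r s n) := by
  have hb : 0 < 1 / (2 * a * r) := by positivity
  have hn : (-1 : ℝ) < (n : ℝ) := by
    have : (0 : ℝ) ≤ n := n.cast_nonneg
    linarith
  have h := ((integrable_rpow_mul_exp_neg_mul_sq hb hn).comp_add_right s).comp_mul_left' ha.ne'
  refine h.congr (Filter.Eventually.of_forall fun x => ?_)
  simp only [affineGaussian, Real.rpow_natCast]
  congr 2
  ring

lemma tendsto_affineGaussian_succ {a r : ℝ} (ha : 0 < a) (hr : 0 < r) (s : ℝ) (n : ℕ) :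
    Filter.Tendsto (affineGaussian a r s (n + 1)) Filter.atTop (nhds 0) :=
  tendsto_zero_of_hasDerivAt_of_integrableOn_Ioi (a := 0)
    (fun x _ => hasDerivAt_affineGaussian_succ ha hr s n x)
    (((integrable_affineGaussian ha hr s n).const_mul _).sub
      ((integrable_affineGaussian ha hr s (n + 2)).div_const r)).integrableOn
    (integrable_affineGaussian ha hr s (n + 1)).integrableOn

lemma tendsto_affineGaussian_zero {a r : ℝ} (ha : 0 < a) (hr : 0 < r) (s : ℝ) :
    Filter.Tendsto (affineGaussian a r s 0) Filter.atTop (nhds 0) :=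
  tendsto_zero_of_hasDerivAt_of_integrableOn_Ioi (a := 0)
    (fun x _ => hasDerivAt_affineGaussian_zero ha hr s x)
    ((integrable_affineGaussian ha hr s 1).neg.div_const r).integrableOn
    (integrable_affineGaussian ha hr s 0).integrableOn

lemma integral_Ioi_vP {a r : ℝ} (ha : 0 < a) (hr : 0 < r) (s x : ℝ) :
    ∫ y in Ioi x, vP a r s y = affineGaussian a r s 1 x / a := by
  have hd : ∀ y ∈ Ici x,
      HasDerivAt (fun y => -affineGaussian a r s 1 y / a) (vP a r s y) y := by
    intro y _
    refine (((hasDerivAt_affineGaussian_succ ha hr s 0 y).neg).div_const a).congr_deriv ?_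
    rw [vP_eq_affineGaussian]
    field_simp
    push_cast
    ring
  have hi : IntegrableOn (vP a r s) (Ioi x) := by
    rw [funext (vP_eq_affineGaussian a r s)]
    exact (((integrable_affineGaussian ha hr s 2).div_const _).sub
      (integrable_affineGaussian ha hr s 0)).integrableOn
  have ht := ((tendsto_affineGaussian_succ ha hr s 0).neg).div_const a
  rw [neg_zero, zero_div] at ht
  rw [integral_Ioi_of_hasDerivAt_of_tendsto' hd hi ht]
  ring

lemma id_mul_vP_eq_affineGaussian {a : ℝ} (ha : 0 < a) (r s x : ℝ) :
    x * vP a r s x = (affineGaussian a r s 3 x - s * affineGaussian a r s 2 x) / (a ^ 2 * r)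
      - (affineGaussian a r s 1 x - s * affineGaussian a r s 0 x) / a := by
  simp only [vP, affineGaussian]
  field_simp
  ring

lemma integral_Ioi_id_mul_vP {a r : ℝ} (ha : 0 < a) (hr : 0 < r) (s : ℝ) :
    ∫ y in Ioi (0 : ℝ), y * vP a r s y = r * affineGaussian a r s 0 0 / a := by
  have hd : ∀ y ∈ Ici (0 : ℝ),
      HasDerivAt (fun y => -(affineGaussian a r s 2 y - s * affineGaussian a r s 1 y) / a ^ 2
        - r * affineGaussian a r s 0 y / a) (y * vP a r s y) y := by
    intro y _
    refine (((((hasDerivAt_affineGaussian_succ ha hr s 1 y).sub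
      ((hasDerivAt_affineGaussian_succ ha hr s 0 y).const_mul s)).neg).div_const (a ^ 2)).sub
      (((hasDerivAt_affineGaussian_zero ha hr s y).const_mul r).div_const a)).congr_deriv ?_
    rw [id_mul_vP_eq_affineGaussian ha]
    field_simp
    push_cast
    ring
  have hi : IntegrableOn (fun y => y * vP a r s y) (Ioi 0) := by
    rw [funext (id_mul_vP_eq_affineGaussian ha r s)]
    have hG := integrable_affineGaussian ha hr s
    exact ((((hG 3).sub ((hG 2).const_mul s)).div_const _).sub
      (((hG 1).sub ((hG 0).const_mul s)).div_const _)).integrableOn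
  have ht := ((((tendsto_affineGaussian_succ ha hr s 1).sub
    ((tendsto_affineGaussian_succ ha hr s 0).const_mul s)).neg).div_const (a ^ 2)).sub
    (((tendsto_affineGaussian_zero ha hr s).const_mul r).div_const a)
  simp only [mul_zero, sub_zero, neg_zero, zero_div] at ht
  rw [integral_Ioi_of_hasDerivAt_of_tendsto' hd hi ht]
  simp only [affineGaussian]
  ring

lemma hasDerivAt_vP {a r : ℝ} (ha : 0 < a) (hr : 0 < r) (s x : ℝ) :
    HasDerivAt (vP a r s)
      (3 * affineGaussian a r s 1 x / r - affineGaussian a r s 3 x / (a * r ^ 2)) x := by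
  rw [funext (vP_eq_affineGaussian a r s)]
  refine (((hasDerivAt_affineGaussian_succ ha hr s 1 x).div_const (a * r)).sub
    (hasDerivAt_affineGaussian_zero ha hr s x)).congr_deriv ?_
  field_simp
  push_cast
  ring

/-- Properties of the Perron eigenfunction of the growth–fragmentation
operator with coefficients `r(x)=r`, `a(x)=ax`, `b(x,y)=2/y`, `β(x)=β₀+β₁x`:
(i) `v` solves `rv'' + (s₀+ax)v' + 3av = 0`;
(ii) `v` solves the eigenvalue equation `s₀v + rv' + axv − 2a∫_x^∞ v = 0` for `x ≥ 0`;
(iii) for `s₀ > 0` the boundary condition `v(0) = β₀∫₀^∞ v + β₁∫₀^∞ yv(y)dy` holds iff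
`s₀² − α₀s₀ − rα₁ = 0` (with `α₀ = rβ₀`, `α₁ = rβ₁ + a`), which holds for `s₀ = λ₊`;
(iv) if `s₀ ≥ √(ar)`, then `v ≥ 0` on `[0,∞)`. -/
theorem perron_eigenfunction (a r β₀ β₁ α₀ α₁ s₀ : ℝ)
    (ha : 0 < a) (hr : 0 < r) (hβ₀ : 0 ≤ β₀) (hβ₁ : 0 ≤ β₁)
    (hα₀ : α₀ = r * β₀) (hα₁ : α₁ = r * β₁ + a) :
    -- (i)
    (∀ x : ℝ, r * deriv (deriv (vP a r s₀)) x
        + (s₀ + a * x) * deriv (vP a r s₀) x + 3 * a * vP a r s₀ x = 0) ∧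
    -- (ii)
    (∀ x : ℝ, 0 ≤ x →
      s₀ * vP a r s₀ x + r * deriv (vP a r s₀) x + a * x * vP a r s₀ x
        - 2 * a * ∫ y in Ioi x, vP a r s₀ y = 0) ∧
    -- (iii)
    (0 < s₀ →
      ((vP a r s₀ 0 = β₀ * (∫ y in Ioi (0:ℝ), vP a r s₀ y)
          + β₁ * ∫ y in Ioi (0:ℝ), y * vP a r s₀ y)
        ↔ s₀ ^ 2 - α₀ * s₀ - r * α₁ = 0)) ∧
    (0 < lamP r α₀ α₁ ∧
      (lamP r α₀ α₁) ^ 2 - α₀ * lamP r α₀ α₁ - r * α₁ = 0) ∧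
    -- (iv)
    (Real.sqrt (a * r) ≤ s₀ → ∀ x : ℝ, 0 ≤ x → 0 ≤ vP a r s₀ x) := by
  have hdv : deriv (vP a r s₀) = fun x =>
      3 * affineGaussian a r s₀ 1 x / r - affineGaussian a r s₀ 3 x / (a * r ^ 2) :=
    funext fun x => (hasDerivAt_vP ha hr s₀ x).deriv
  have hα₁_pos : 0 < α₁ := by rw [hα₁]; positivity
  have hα₀_nonneg : 0 ≤ α₀ := by rw [hα₀]; positivity
  refine ⟨fun x => ?_, fun x _ => ?_, fun _ => ?_, ⟨?_, ?_⟩, fun hs x hx => ?_⟩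
  · have hdd := (((hasDerivAt_affineGaussian_succ ha hr s₀ 0 x).const_mul 3).div_const r).sub
      ((hasDerivAt_affineGaussian_succ ha hr s₀ 2 x).div_const (a * r ^ 2))
    have hddv := hdd.deriv
    rw [hdv]
    refine (congrArg (fun d => r * d + _ + _) hddv).trans ?_
    rw [vP_eq_affineGaussian]
    simp only [affineGaussian]
    field_simp
    push_cast
    ring
  · rw [integral_Ioi_vP ha hr, hdv, vP_eq_affineGaussian]
    simp only [affineGaussian]
    field_simp
    ring
  · rw [integral_Ioi_vP ha hr, integral_Ioi_id_mul_vP ha hr, hα₀, hα₁]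
    simp only [vP, affineGaussian, mul_zero, zero_add]
    have hE := Real.exp_pos (-s₀ ^ 2 / (2 * a * r))
    set E := Real.exp (-s₀ ^ 2 / (2 * a * r))
    have key : E * (s₀ ^ 2 / (a * r) - 1) - (β₀ * (s₀ ^ 1 * E / a) + β₁ * (r * (s₀ ^ 0 * E) / a))
        = E / (a * r) * (s₀ ^ 2 - r * β₀ * s₀ - r * (r * β₁ + a)) := by
      field_simp
      ring
    rw [← sub_eq_zero, key, mul_eq_zero]
    exact or_iff_right (by positivity)
  · unfold lamP
    have : 0 < Real.sqrt (α₀ ^ 2 + 4 * r * α₁) := Real.sqrt_pos.2 (by positivity)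
    positivity
  · unfold lamP
    have := Real.sq_sqrt (show 0 ≤ α₀ ^ 2 + 4 * r * α₁ by positivity)
    linear_combination this / 4
  · have har : 0 < a * r := mul_pos ha hr
    have hle : Real.sqrt (a * r) ≤ a * x + s₀ := by linarith [mul_nonneg ha.le hx]
    have hsq : a * r ≤ (a * x + s₀) ^ 2 :=
      (Real.sqrt_le_left ((Real.sqrt_nonneg _).trans hle)).1 hle
    exact mul_nonneg (Real.exp_pos _).le (sub_nonneg.2 ((one_le_div har).2 hsq))
end

section
/- Let a, r > 0, β₀, β₁ ≥ 0, α₀ = rβ₀, α₁ = rβ₁ + a, and λ ∈ ℝ. The function w(x) = λ + α₁x satisfies λ w(x) − r w'(x) + a x w(x) − 2a ∫₀^x w(y) dy − r(β₀ + β₁x) w(0) = 0 for all x ≥ 0 if and only if λ² − α₀λ − rα₁ = 0; in particular w(x) = λ₊ + α₁x, with λ₊ = (α₀ + √(α₀² + 4rα₁))/2, is a positive solution of the transpose eigenvalue problem. -/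
open MeasureTheory Set

/-- The affine function `w(x) = λ + α₁x` solves the transpose eigenvalue
problem `λw − rw' + axw − 2a∫₀^x w − r(β₀+β₁x)w(0) = 0` on `[0,∞)` if and only if
`λ² − α₀λ − rα₁ = 0` (with `α₀ = rβ₀`, `α₁ = rβ₁ + a`); in particular `w(x) = λ₊ + α₁x`
is a positive solution. -/
theorem transpose_perron_eigenfunction (a r β₀ β₁ α₀ α₁ lam : ℝ)
    (ha : 0 < a) (hr : 0 < r) (hβ₀ : 0 ≤ β₀) (hβ₁ : 0 ≤ β₁)
    (hα₀ : α₀ = r * β₀) (hα₁ : α₁ = r * β₁ + a) :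
    ((∀ x : ℝ, 0 ≤ x →
        lam * (lam + α₁ * x) - r * deriv (fun y => lam + α₁ * y) x
          + a * x * (lam + α₁ * x)
          - 2 * a * (∫ y in (0:ℝ)..x, (lam + α₁ * y))
          - r * (β₀ + β₁ * x) * (lam + α₁ * 0) = 0)
      ↔ lam ^ 2 - α₀ * lam - r * α₁ = 0) ∧
    ((lamP r α₀ α₁) ^ 2 - α₀ * lamP r α₀ α₁ - r * α₁ = 0 ∧
      ∀ x : ℝ, 0 ≤ x → 0 < lamP r α₀ α₁ + α₁ * x) := by
  have hα₁_pos : 0 < α₁ := by rw [hα₁]; positivity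
  refine ⟨?_, ?_, ?_⟩
  · have residual_eq (x : ℝ) :
        lam * (lam + α₁ * x) - r * deriv (fun y => lam + α₁ * y) x
          + a * x * (lam + α₁ * x)
          - 2 * a * (∫ y in (0:ℝ)..x, (lam + α₁ * y))
          - r * (β₀ + β₁ * x) * (lam + α₁ * 0) = lam ^ 2 - α₀ * lam - r * α₁ := by
      have hderiv : deriv (fun y => lam + α₁ * y) x = α₁ := by
        simp
      have hint : (∫ y in (0:ℝ)..x, (lam + α₁ * y)) = lam * x + α₁ * (x ^ 2 / 2) := by
        rw [intervalIntegral.integral_add (Continuous.intervalIntegrable (by fun_prop) _ _)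
            (Continuous.intervalIntegrable (by fun_prop) _ _),
          intervalIntegral.integral_const_mul, integral_id, intervalIntegral.integral_const,
          smul_eq_mul]
        ring
      rw [hderiv, hint, hα₀, hα₁]
      ring
    simp only [residual_eq]
    exact ⟨fun h => h 0 le_rfl, fun h _ _ => h⟩
  · have hsq := Real.sq_sqrt (show 0 ≤ α₀ ^ 2 + 4 * r * α₁ by positivity)
    unfold lamP
    linear_combination hsq / 4
  · intro x hx
    have hα₀_nonneg : 0 ≤ α₀ := by rw [hα₀]; positivity
    unfold lamP
    positivity
end
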